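/- The following relations hold in Q: (P1) a^{(ba)^{3(2k-1)}} = a, and (P2) b^{(ab)^{3(2k-1)}} = b. -/

import Mathlib

/-- A quandle in the paper's (right-action) conventions: `op x y` is `x ▷ y` (written `x^y`)
and `inv x y` is `x ▷⁻¹ y` (written `x^{ȳ}`). -/
structure LinkQuandle (Q : Type*) where
  op : Q → Q → Q
  inv : Q → Q → Q
  idem : ∀ x, op x x = x
  inv_op : ∀ x y, inv (op x y) y = x
  op_inv : ∀ x y, op (inv x y) y = x
  distrib : ∀ x y z, op (op x y) z = op (op x z) (op y z)

/-- `opPow q y n x` is `x^{yⁿ}`: act on `x` by `y`, `n` times. -/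
def LinkQuandle.opPow {Q : Type*} (q : LinkQuandle Q) (y : Q) (n : ℕ) (x : Q) : Q :=
  (fun z => q.op z y)^[n] x

/-- `pairPow q y z t x` is `x^{(yz)^t}`: act on `x` by `y` then `z`, `t` times. -/
def LinkQuandle.pairPow {Q : Type*} (q : LinkQuandle Q) (y z : Q) (t : ℕ) (x : Q) : Q :=
  (fun w => q.op (q.op w y) z)^[t] x

/-- The smallest subset of `Q` containing `S` and closed under acting (and inversely acting)
by every element of `S`. -/
def LinkQuandle.genClosure {Q : Type*} (q : LinkQuandle Q) (S : Set Q) : Set Q :=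
  ⋂₀ {T : Set Q | S ⊆ T ∧ ∀ x ∈ T, ∀ s ∈ S, q.op x s ∈ T ∧ q.inv x s ∈ T}

namespace LinkQuandle

variable {Q : Type*} (q : LinkQuandle Q)

/-- The permutation `x ↦ x ▷ y` of a quandle. -/
def act (y : Q) : Equiv.Perm Q where
  toFun x := q.op x y
  invFun x := q.inv x y
  left_inv x := q.inv_op x y
  right_inv x := q.op_inv x y

theorem act_op (x y : Q) : q.act (q.op x y) = q.act y * q.act x * (q.act y)⁻¹ := by
  rw [eq_mul_inv_iff_mul_eq]
  ext z
  exact (q.distrib z x y).symm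

/-- The permutations `g` of a quandle for which `act` is equivariant. -/
def equivariant : Subgroup (Equiv.Perm Q) where
  carrier := {g | ∀ x, q.act (g x) = g * q.act x * g⁻¹}
  one_mem' := fun x => by simp
  mul_mem' := fun {g h} hg hh x => by
    rw [Equiv.Perm.mul_apply, hg, hh]
    group
  inv_mem' := fun {g} hg x => by
    have h := hg (g⁻¹ x)
    rw [show g (g⁻¹ x) = x from g.apply_symm_apply x] at h
    rw [h]
    group

theorem act_mem_equivariant (y : Q) : q.act y ∈ q.equivariant := fun x => q.act_op x y

theorem pairPow_eq (y z : Q) (t : ℕ) (x : Q) :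
    q.pairPow y z t x = ((q.act z * q.act y) ^ t) x := by
  rw [← Equiv.Perm.iterate_eq_pow]
  rfl

end LinkQuandle

theorem pow_mul_mul_pow_inv_of_involutions {G : Type*} [Group G] {A B : G}
    (hA : A * A = 1) (hB : B * B = 1) (m : ℕ) :
    (B * A) ^ m * B * ((B * A) ^ m)⁻¹ = (B * A) ^ (2 * m + 1) * A := by
  have hs : SemiconjBy B (B * A)⁻¹ (B * A) := by
    simp [SemiconjBy, inv_eq_of_mul_eq_one_left hA, inv_eq_of_mul_eq_one_left hB, mul_assoc]
  have hs' := (hs.pow_right m).eq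
  rw [inv_pow] at hs'
  rw [mul_assoc, hs', ← mul_assoc, ← pow_add, ← two_mul, pow_succ, mul_assoc, mul_assoc B A A, hA,
    mul_one]

theorem mul_sq_eq_cube {G : Type*} [Group G] {x y S : G} (hx : Commute x S) (hy : Commute y S)
    (hxx : x * x = S) (hyy : y * y = S⁻¹) (h : y * x⁻¹ * (y * x⁻¹) = S) :
    x * y * (x * y) = S ^ 3 := by
  have hxi : x⁻¹ = S⁻¹ * x := by rw [← hxx]; group
  have hyx : y * x = S ^ 3 * x * y := by
    have hyi : y⁻¹ = S * y := by rw [← inv_inv S, ← hyy]; group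
    have e : y * x⁻¹ = S * (x * y⁻¹) := by
      rw [← h]
      group
    rw [hyi, hxi] at e
    calc y * x = S * (y * (S⁻¹ * x)) := by
          rw [← mul_assoc y, hy.inv_right.eq, mul_assoc, mul_inv_cancel_left]
      _ = S * S * (x * S) * y := by rw [e]; simp only [mul_assoc]
      _ = S ^ 3 * x * y := by rw [hx.eq, pow_three]; simp only [mul_assoc]
  calc x * y * (x * y) = x * (y * x) * y := by simp only [mul_assoc]
    _ = (x * S ^ 3) * x * (y * y) := by rw [hyx]; simp only [mul_assoc]
    _ = S ^ 3 := by
      rw [(hx.pow_right 3).eq, hyy, mul_assoc (S ^ 3), hxx, mul_inv_cancel_right]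

/-- If `A` is an involution inverting `S`, `C` has order dividing three and commutes with `S`, and
the square of `A ^ C * A` is `S`, then `A`, `A ^ C` and `A ^ C²` satisfy a quaternion-like
relation. -/
theorem sq_eq_cube_of_involution_conj {G : Type*} [Group G] {A C S u v : G}
    (hA : A * A = 1) (hC : C * C * C = 1) (hCS : C * S = S * C) (hAS : A * S = S⁻¹ * A)
    (hu : u = C * A * C⁻¹) (hv : v = C⁻¹ * A * C) (h : u * A * (u * A) = S) :
    (u * A * (v * A)) * (u * A * (v * A)) = S ^ 3 := by
  have hSC : MulAut.conj C S = S := by simp [MulAut.conj_apply, hCS]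
  have hCA : MulAut.conj C A = u := by simp [hu]
  have hCC : C * C = C⁻¹ := eq_inv_of_mul_eq_one_left hC
  have hCu : MulAut.conj C u = v := by
    have : C⁻¹ * C⁻¹ = C := by rw [← mul_inv_rev, hCC, inv_inv]
    calc MulAut.conj C u = (C * C) * A * (C⁻¹ * C⁻¹) := by simp [hu, mul_assoc]
      _ = v := by rw [hCC, this, hv]
  have hCv : MulAut.conj C v = A := by simp [hv, mul_assoc]
  have h₁ : v * u * (v * u) = S := by
    simpa only [map_mul, hSC, hCA, hCu] using congrArg (MulAut.conj C) h
  have h₂ : A * v * (A * v) = S := by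
    simpa only [map_mul, hSC, hCv, hCu] using congrArg (MulAut.conj C) h₁
  have huS : u * S = S⁻¹ * u := by
    simpa only [map_mul, map_inv, hSC, hCA] using congrArg (MulAut.conj C) hAS
  have hvS : v * S = S⁻¹ * v := by
    simpa only [map_mul, map_inv, hSC, hCu] using congrArg (MulAut.conj C) huS
  have hAi : A⁻¹ = A := inv_eq_of_mul_eq_one_left hA
  have inv_swap : ∀ g : G, g * S = S⁻¹ * g → g * S⁻¹ = S * g := fun g hg => by
    rw [mul_inv_eq_iff_eq_mul, mul_assoc, hg, mul_inv_cancel_left]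
  have hx : Commute (u * A) S := by
    change u * A * S = S * (u * A)
    rw [mul_assoc, hAS, ← mul_assoc, inv_swap u huS, mul_assoc]
  have hy : Commute (v * A) S := by
    change v * A * S = S * (v * A)
    rw [mul_assoc, hAS, ← mul_assoc, inv_swap v hvS, mul_assoc]
  have hyy : v * A * (v * A) = S⁻¹ := by
    calc v * A * (v * A) = (A * A) * (v * A * (v * A)) := by rw [hA, one_mul]
      _ = A * (A * v * (A * v)) * A := by simp only [mul_assoc]
      _ = S⁻¹ := by rw [h₂, hAS, mul_assoc, hA, mul_one]
  have huu : u * u = 1 := by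
    simpa only [map_mul, map_one, hCA] using congrArg (MulAut.conj C) hA
  have hyx : v * A * (u * A)⁻¹ = v * u := by
    rw [mul_inv_rev, hAi, inv_eq_of_mul_eq_one_left huu, mul_assoc, ← mul_assoc A A, hA, one_mul]
  exact mul_sq_eq_cube hx hy h hyy (by rw [hyx, h₁])

theorem stmt15 {Q : Type*} (q : LinkQuandle Q) (a b c : Q) (k : ℕ) (hk : 1 ≤ k)
    (h1 : q.op (q.op c b) a = c)
    (h2 : q.op (q.inv (q.op (q.op a c) a) c) a = q.op (q.op (q.inv a c) a) c)
    (h3 : q.op (q.op (q.inv a c) a) c = q.pairPow a b (k - 1) b)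
    (ha : ∀ x : Q, q.op (q.op x a) a = x)
    (hb : ∀ x : Q, q.op (q.op x b) b = x)
    (hc : ∀ x : Q, q.op (q.op (q.op x c) c) c = x) :
    q.pairPow b a (3 * (2 * k - 1)) a = a ∧
    q.pairPow a b (3 * (2 * k - 1)) b = b := by
  obtain ⟨m, rfl⟩ : ∃ m, k = m + 1 := ⟨k - 1, by omega⟩
  rw [show 2 * (m + 1) - 1 = 2 * m + 1 by omega]
  rw [Nat.add_sub_cancel] at h3
  simp only [q.pairPow_eq] at h3 ⊢
  have hAa : q.act a a = a := q.idem a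
  have hAm := q.act_mem_equivariant a
  have hBm := q.act_mem_equivariant b
  have hCm := q.act_mem_equivariant c
  have hA : q.act a * q.act a = 1 := Equiv.ext ha
  have hB : q.act b * q.act b = 1 := Equiv.ext hb
  have hC : q.act c * q.act c * q.act c = 1 := Equiv.ext hc
  have hT := congrArg q.act h1
  rw [q.act_op, q.act_op] at hT
  have hact := congrArg q.act h3
  rw [Subgroup.pow_mem _ (mul_mem hBm hAm) m b, pow_mul_mul_pow_inv_of_involutions hA hB] at hact
  change (q.act c * q.act a * (q.act c)⁻¹) a = _ at h3
  change q.act ((q.act c * q.act a * (q.act c)⁻¹) a) = _ at hact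
  change (q.act a * ((q.act c)⁻¹ * q.act a * q.act c)) a =
    (q.act c * q.act a * (q.act c)⁻¹) a at h2
  rw [mul_mem (mul_mem hCm hAm) (inv_mem hCm) a] at hact
  generalize q.act a = A at *
  generalize q.act b = B at *
  generalize q.act c = C at *
  have hAi : A⁻¹ = A := inv_eq_of_mul_eq_one_left hA
  have hBi : B⁻¹ = B := inv_eq_of_mul_eq_one_left hB
  have hTi : (B * A)⁻¹ = A * B := by rw [mul_inv_rev, hAi, hBi]
  have hCS : Commute C ((B * A) ^ (2 * m + 1)) := by
    refine Commute.pow_right (Commute.inv_right_iff.1 ?_) _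
    rw [hTi]
    rw [hBi, mul_inv_eq_iff_eq_mul, ← mul_assoc, ← mul_assoc] at hT
    have hT' := congrArg (· * B) hT
    simp only [mul_assoc, hB, mul_one] at hT'
    simpa only [Commute, SemiconjBy, mul_assoc] using hT'.symm
  have hAS : A * (B * A) ^ (2 * m + 1) = ((B * A) ^ (2 * m + 1))⁻¹ * A := by
    have : SemiconjBy A (B * A) (B * A)⁻¹ := by
      rw [hTi]
      simp [SemiconjBy, mul_assoc]
    simpa only [inv_pow] using (this.pow_right (2 * m + 1)).eq
  have hTS : Commute ((B * A) ^ m) ((B * A) ^ (2 * m + 1)) := Commute.pow_pow_self _ _ _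
  rw [← hTi, inv_pow, mul_comm 3, pow_mul]
  generalize (B * A) ^ (2 * m + 1) = S at *
  set u := C * A * C⁻¹ with hu
  set v := C⁻¹ * A * C with hv
  have hCA : MulAut.conj C A = u := rfl
  have huu : u * u = 1 := by
    simpa only [map_mul, map_one, hCA] using congrArg (MulAut.conj C) hA
  have huS : SemiconjBy u S S⁻¹ := by
    have hSC : MulAut.conj C S = S := by simp [MulAut.conj_apply, hCS.eq]
    change u * S = S⁻¹ * u
    simpa only [map_mul, map_inv, hSC, hCA] using congrArg (MulAut.conj C) hAS
  have hS : u * A * (u * A) = S := by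
    rw [inv_eq_of_mul_eq_one_left huu] at hact
    rw [← mul_assoc, hact, mul_assoc, hA, mul_one]
  have hw := sq_eq_cube_of_involution_conj hA hC hCS.eq hAS hu hv hS
  have hwa : (u * A * (v * A)) a = a := by
    change u (A (v (A a))) = a
    rw [hAa]
    change u ((A * v) a) = a
    rw [h2]
    exact Equiv.congr_fun huu a
  have hSa : (S ^ 3) a = a := by
    rw [← hw, Equiv.Perm.mul_apply, hwa, hwa]
  have hSa' : (S ^ 3)⁻¹ a = a := Equiv.Perm.inv_eq_iff_eq.2 hSa.symm
  refine ⟨hSa', ((B * A) ^ m).injective ?_⟩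
  have huS3 : S ^ 3 * u = u * (S ^ 3)⁻¹ := by
    simpa using (huS.inv_right.pow_right 3).eq.symm
  rw [← Equiv.Perm.mul_apply, (hTS.pow_right 3).eq, Equiv.Perm.mul_apply, ← h3,
    ← Equiv.Perm.mul_apply, huS3, Equiv.Perm.mul_apply, hSa']
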